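/- Every pH system is passive: let (J,R,Q,G,F,S,N) be pH system data of state dimension n and port dimension m, let u : ℝ → ℝᵐ be continuous, let x : ℝ → ℝⁿ be differentiable with ẋ(t) = (J−R)Qx(t) + (G−F)u(t) for all t, and set y(t) = (G+F)ᵀQx(t) + (S−N)u(t). Then for all 0 ≤ t₀ ≤ t₁, the dissipation inequality H(x(t₁)) ≤ H(x(t₀)) + ∫_{t₀}^{t₁} y(t) ⬝ u(t) dt holds, where H(x) = ½xᵀQx. -/

import Mathlib

open Matrix

/-- The quadratic form of a real skew-symmetric matrix vanishes. -/
theorem dotProduct_mulVec_self_eq_zero_of_transpose_eq_neg {ι : Type*} [Fintype ι]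
    {A : Matrix ι ι ℝ} (hA : Aᵀ = -A) (v : ι → ℝ) : v ⬝ᵥ A *ᵥ v = 0 := by
  have h : v ⬝ᵥ A *ᵥ v = -(v ⬝ᵥ A *ᵥ v) := by
    conv_lhs => rw [dotProduct_mulVec, ← mulVec_transpose, hA, neg_mulVec, neg_dotProduct,
      dotProduct_comm]
  linarith

/-- The product rule for the dot product of two curves. -/
theorem HasDerivAt.dotProduct {ι : Type*} [Fintype ι] {f g : ℝ → ι → ℝ} {f' g' : ι → ℝ} {t : ℝ}
    (hf : HasDerivAt f f' t) (hg : HasDerivAt g g' t) :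
    HasDerivAt (fun s => f s ⬝ᵥ g s) (f' ⬝ᵥ g t + f t ⬝ᵥ g') t := by
  simp only [_root_.dotProduct, ← Finset.sum_add_distrib]
  exact HasDerivAt.fun_sum fun i _ => (hasDerivAt_pi.1 hf i).mul (hasDerivAt_pi.1 hg i)

/-- The derivative of a quadratic form with symmetric matrix along a curve. -/
theorem HasDerivAt.half_quadratic_form {ι : Type*} [Fintype ι] {Q : Matrix ι ι ℝ} (hQ : Qᵀ = Q)
    {x : ℝ → ι → ℝ} {x' : ι → ℝ} {t : ℝ} (hx : HasDerivAt x x' t) :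
    HasDerivAt (fun s => (1 / 2) * (x s ⬝ᵥ Q *ᵥ x s)) (Q *ᵥ x t ⬝ᵥ x') t := by
  have hQx : HasDerivAt (fun s => Q *ᵥ x s) (Q *ᵥ x') t :=
    (LinearMap.toContinuousLinearMap Q.mulVecLin).hasFDerivAt.comp_hasDerivAt t hx
  refine ((hx.dotProduct hQx).const_mul (1 / 2 : ℝ)).congr_deriv ?_
  rw [dotProduct_comm x', dotProduct_mulVec (x t), ← mulVec_transpose, hQ]
  ring

/-- The stored power `z ⬝ ((J - R) z + (G - F) u)` of port-Hamiltonian data is at most the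
supplied power. -/
theorem stored_power_le_supplied_power {ι κ : Type*} [Fintype ι] [Fintype κ]
    {J R : Matrix ι ι ℝ} {G F : Matrix ι κ ℝ} {S N : Matrix κ κ ℝ}
    (hJ : Jᵀ = -J) (hN : Nᵀ = -N) (hW : (fromBlocks R F Fᵀ S).PosSemidef)
    (z : ι → ℝ) (u : κ → ℝ) :
    z ⬝ᵥ ((J - R) *ᵥ z + (G - F) *ᵥ u) ≤ ((G + F)ᵀ *ᵥ z + (S - N) *ᵥ u) ⬝ᵥ u := by
  have hpos := hW.dotProduct_mulVec_nonneg (Sum.elim z u)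
  have hJz := dotProduct_mulVec_self_eq_zero_of_transpose_eq_neg hJ z
  have hNu := dotProduct_mulVec_self_eq_zero_of_transpose_eq_neg hN u
  have hFt : u ⬝ᵥ Fᵀ *ᵥ z = z ⬝ᵥ F *ᵥ u := by
    rw [mulVec_transpose, dotProduct_comm, dotProduct_mulVec]
  have hGt : u ⬝ᵥ Gᵀ *ᵥ z = z ⬝ᵥ G *ᵥ u := by
    rw [mulVec_transpose, dotProduct_comm, dotProduct_mulVec]
  simp only [star_trivial, fromBlocks_mulVec, sumElim_dotProduct_sumElim, Sum.elim_comp_inl,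
    Sum.elim_comp_inr, dotProduct_add, hFt] at hpos
  rw [dotProduct_comm _ u]
  simp only [transpose_add, add_mulVec, sub_mulVec, dotProduct_add, dotProduct_sub, hFt, hGt,
    hJz, hNu]
  linarith

/-- Every pH system is passive: along any trajectory of
`ẋ = (J−R)Qx + (G−F)u`, `y = (G+F)ᵀQx + (S−N)u` with continuous input `u`, the dissipation
inequality `H(x(t₁)) ≤ H(x(t₀)) + ∫_{t₀}^{t₁} y(t)⬝u(t) dt` holds for all `0 ≤ t₀ ≤ t₁`,
where `H(x) = ½ xᵀQx`. -/
theorem pH_system_is_passive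
    (n m : ℕ)
    (J R Q : Matrix (Fin n) (Fin n) ℝ) (G F : Matrix (Fin n) (Fin m) ℝ)
    (S N : Matrix (Fin m) (Fin m) ℝ)
    (hJ : Jᵀ = -J) (hN : Nᵀ = -N) (hQ : Q.PosDef)
    (hW : (Matrix.fromBlocks R F Fᵀ S).PosSemidef)
    (u : ℝ → Fin m → ℝ) (hu : Continuous u)
    (x : ℝ → Fin n → ℝ)
    (hx : ∀ t : ℝ, HasDerivAt x (((J - R) * Q).mulVec (x t) + (G - F).mulVec (u t)) t)
    (y : ℝ → Fin m → ℝ)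
    (hy : ∀ t : ℝ, y t = ((G + F)ᵀ * Q).mulVec (x t) + (S - N).mulVec (u t))
    (H : (Fin n → ℝ) → ℝ)
    (hH : ∀ ξ : Fin n → ℝ, H ξ = (1 / 2) * (ξ ⬝ᵥ Q.mulVec ξ)) :
    ∀ t₀ t₁ : ℝ, 0 ≤ t₀ → t₀ ≤ t₁ →
      H (x t₁) ≤ H (x t₀) + ∫ t in t₀..t₁, (y t) ⬝ᵥ (u t) := by
  intro t₀ t₁ _ ht
  have hxc : Continuous x := continuous_iff_continuousAt.2 fun t => (hx t).continuousAt
  have hyc : Continuous y := by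
    rw [funext hy]
    fun_prop
  have hQt : Qᵀ = Q := by simpa using hQ.isHermitian.eq
  have hderiv := fun t => (hx t).half_quadratic_form hQt
  have hFTC := intervalIntegral.integral_eq_sub_of_hasDerivAt (a := t₀) (b := t₁)
    (fun t _ => hderiv t) (Continuous.intervalIntegrable (by fun_prop) _ _)
  have hmono := intervalIntegral.integral_mono_on (μ := MeasureTheory.volume) ht
    (f := fun t => Q *ᵥ x t ⬝ᵥ (((J - R) * Q) *ᵥ x t + (G - F) *ᵥ u t)) (g := fun t => y t ⬝ᵥ u t)
    (Continuous.intervalIntegrable (by fun_prop) _ _)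
    (Continuous.intervalIntegrable (by fun_prop) _ _) fun t _ => by
      simpa only [hy, mulVec_mulVec] using
        stored_power_le_supplied_power (G := G) hJ hN hW (Q *ᵥ x t) (u t)
  rw [hH, hH]
  linarith
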